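/- For every n ≥ 0, the list 𝒮_n has exactly r_n entries and contains every Schröder path of length n exactly once. -/

import Mathlib

/-- Steps of a Schröder path: `u = (1,1)`, `d = (1,-1)`, `e = (2,0)`. -/
inductive Step : Type
  | u : Step
  | d : Step
  | e : Step
deriving DecidableEq, Repr

/-- The large Schröder numbers: `r 0 = 1` and
`r n = r (n-1) + ∑_{k=1}^{n} r (k-1) * r (n-k)` for `n > 0`. -/
def schroder : ℕ → ℕ
  | 0 => 1
  | n + 1 =>
    schroder n + ∑ k ∈ (Finset.range (n + 1)).attach, schroder k.1 * schroder (n - k.1)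
decreasing_by
  · omega
  · have := k.2; simp only [Finset.mem_range] at this; omega
  · omega

/-- `B 1 = 0` and `B i = r_0 + ⋯ + r_{i-2}` for `i > 1`. -/
def B (i : ℕ) : ℕ := ∑ m ∈ Finset.range (i - 1), schroder m

/-- `L^i`: the list `L` if `i` is odd, `L` reversed if `i` is even. -/
def altS (L : List (List Step)) (i : ℕ) : List (List Step) :=
  if i % 2 = 1 then L else L.reverse

/-- `L(j)`: the `j`-th entry of the list `L` (entries numbered from 1). -/
def entS (L : List (List Step)) (j : ℕ) : List Step := L.getD (j - 1) []

/-- The recursively defined list `𝒮_n` of Schröder paths: `𝒮_0` consists of the empty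
path, and `𝒮_n` is the concatenation of `e⬝𝒮_{n-1}(i)` for `i = 1,…,r_{n-1}` followed by,
for `i = 1,…,n`, `j = 1,…,r_{i-1}`, `k = 1,…,r_{n-i}`, the path
`u⬝𝒮_{i-1}^{n+i}(j)⬝d⬝𝒮_{n-i}^{j+B(i)+1}(k)`. -/
def Slist : ℕ → List (List Step)
  | 0 => [[]]
  | n + 1 =>
    ((Slist n).map fun p => Step.e :: p) ++
      ((List.range (n + 1)).attach.flatMap fun i =>
        (List.range (schroder i.1)).flatMap fun j =>
          (List.range (schroder (n - i.1))).flatMap fun k =>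
            [Step.u :: entS (altS (Slist i.1) (n + 1 + (i.1 + 1))) (j + 1) ++
              Step.d :: entS (altS (Slist (n - i.1)) (j + 1 + B (i.1 + 1) + 1)) (k + 1)])
decreasing_by
  · omega
  · have := i.2; simp only [List.mem_range] at this; omega
  · omega

/-- Expand a path by replacing every level step `e = (2,0)` by two unit level steps. -/
def expand (p : List Step) : List Step :=
  p.flatMap fun s => match s with
    | Step.e => [Step.e, Step.e]
    | s => [s]

/-- `d(p₁,p₂)`: the number of places in which two Schröder paths differ when every
step `e` is replaced by two unit level steps. -/
def dpath (p q : List Step) : ℕ :=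
  (((expand p).zip (expand q)).filter fun x => x.1 != x.2).length

/-- The vertical displacement of a step. -/
def ycost : Step → ℤ
  | Step.u => 1
  | Step.d => -1
  | Step.e => 0

/-- The horizontal displacement of a step. -/
def xcost : Step → ℕ
  | Step.u => 1
  | Step.d => 1
  | Step.e => 2

/-- `p` is a Schröder path of length `n`: it goes from `(0,0)` to `(2n,0)` and never
goes below the `x`-axis. -/
def IsSchroder (n : ℕ) (p : List Step) : Prop :=
  (p.map xcost).sum = 2 * n ∧ (p.map ycost).sum = 0 ∧
    ∀ q : List Step, q <+: p → 0 ≤ (q.map ycost).sum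

lemma altS_perm (L : List (List Step)) (i : ℕ) : (altS L i).Perm L := by
  unfold altS
  split
  · exact List.Perm.refl _
  · exact List.reverse_perm L

lemma map_entS_range (L : List (List Step)) :
    (List.range L.length).map (fun k => entS L (k + 1)) = L := by
  apply List.ext_getElem
  · simp
  · intro k h _
    simp only [List.length_map, List.length_range] at h
    simp [entS, h]

lemma map_entS_altS {α : Type*} (f : List Step → α) (L : List (List Step)) (i m : ℕ)
    (h : L.length = m) :
    ((List.range m).map fun k => f (entS (altS L i) (k + 1))).Perm (L.map f) := by
  have h' : (altS L i).length = m := (altS_perm L i).length_eq.trans h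
  have key := congrArg (List.map f) (map_entS_range (altS L i))
  rw [h', List.map_map] at key
  exact (List.Perm.of_eq key).trans ((altS_perm L i).map f)

lemma flatMap_entS_altS {α : Type*} (f : List Step → List α) (L : List (List Step)) (i m : ℕ)
    (h : L.length = m) :
    ((List.range m).flatMap fun k => f (entS (altS L i) (k + 1))).Perm (L.flatMap f) := by
  rw [List.flatMap_def, List.flatMap_def]
  exact (map_entS_altS f L i m h).flatten

/-- The first-return decomposition: all paths `u⬝a⬝d⬝b` with `a ∈ 𝒮_i` and `b ∈ 𝒮_{n-i}`. -/
def returnPaths (n i : ℕ) : List (List Step) :=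
  (Slist i).flatMap fun a => (Slist (n - i)).map fun b => Step.u :: a ++ Step.d :: b

lemma Slist_succ_perm (n : ℕ) (h : ∀ m ≤ n, (Slist m).length = schroder m) :
    (Slist (n + 1)).Perm
      ((Slist n).map (Step.e :: ·) ++ (List.range (n + 1)).flatMap (returnPaths n)) := by
  rw [Slist]
  refine List.Perm.append_left _ ?_
  have unattach : (List.range (n + 1)).flatMap (returnPaths n) =
      (List.range (n + 1)).attach.flatMap fun i => returnPaths n i.1 := by
    conv_lhs => rw [← List.attach_map_subtype_val (List.range (n + 1)), List.flatMap_map]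
  rw [unattach]
  refine List.Perm.flatMap_left _ fun i _ => ?_
  have hi : i.1 ≤ n := by
    have := i.2
    simp only [List.mem_range] at this
    omega
  refine List.Perm.trans (List.Perm.flatMap_left _ fun j _ => ?_)
    (flatMap_entS_altS (fun a => (Slist (n - i.1)).map fun b => Step.u :: a ++ Step.d :: b)
      (Slist i.1) (n + 1 + (i.1 + 1)) _ (h _ hi))
  rw [← List.map_eq_flatMap]
  exact map_entS_altS
    (fun b => Step.u :: entS (altS (Slist i.1) (n + 1 + (i.1 + 1))) (j + 1) ++ Step.d :: b)
    _ _ _ (h _ (by omega))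

lemma length_Slist (n : ℕ) : (Slist n).length = schroder n := by
  induction n using Nat.strong_induction_on with
  | _ n ih =>
    cases n with
    | zero => simp [Slist, schroder]
    | succ n =>
      rw [(Slist_succ_perm n fun m hm => ih m (by omega)).length_eq, schroder,
        Finset.sum_attach (Finset.range (n + 1)) fun k => schroder k * schroder (n - k),
        List.length_append, List.length_map, ih n (by omega), List.length_flatMap,
        Finset.sum_range, ← List.sum_ofFn, List.ofFn_eq_map, ← List.map_coe_finRange_eq_range,
        List.map_map]
      congr 2
      refine List.map_congr_left fun i _ => ?_
      have hi := i.2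
      simp [returnPaths, List.length_flatMap, ih i.1 (by omega), ih (n - i.1) (by omega)]

lemma Slist_succ_perm_returnPaths (n : ℕ) :
    (Slist (n + 1)).Perm
      ((Slist n).map (Step.e :: ·) ++ (List.range (n + 1)).flatMap (returnPaths n)) :=
  Slist_succ_perm n fun m _ => length_Slist m

lemma mem_Slist_succ (n : ℕ) (p : List Step) :
    p ∈ Slist (n + 1) ↔ (∃ q ∈ Slist n, p = Step.e :: q) ∨
      ∃ i ≤ n, ∃ a ∈ Slist i, ∃ b ∈ Slist (n - i), p = Step.u :: a ++ Step.d :: b := by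
  rw [(Slist_succ_perm_returnPaths n).mem_iff]
  simp [returnPaths, eq_comm]

lemma List.IsPrefix.of_append {α : Type*} {q a b : List α} (h : q <+: a ++ b) :
    q <+: a ∨ ∃ s, s <+: b ∧ q = a ++ s := by
  obtain ⟨t, ht⟩ := h
  rcases List.append_eq_append_iff.1 ht with ⟨s, hs, -⟩ | ⟨s, hs, hs'⟩
  · exact Or.inl ⟨s, hs.symm⟩
  · exact Or.inr ⟨s, ⟨t, hs'.symm⟩, hs⟩

lemma IsSchroder.nil : IsSchroder 0 [] := by
  simp [IsSchroder]

lemma isSchroder_e_cons (n : ℕ) (p : List Step) :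
    IsSchroder (n + 1) (Step.e :: p) ↔ IsSchroder n p := by
  constructor
  · rintro ⟨hx, hy, hq⟩
    refine ⟨?_, ?_, fun q h => ?_⟩
    · simp [xcost] at hx
      omega
    · simpa [ycost] using hy
    · simpa [ycost] using hq (Step.e :: q) (List.cons_prefix_cons.2 ⟨rfl, h⟩)
  · rintro ⟨hx, hy, hq⟩
    refine ⟨?_, ?_, fun q h => ?_⟩
    · simp [xcost]
      omega
    · simpa [ycost] using hy
    · rcases List.prefix_cons_iff.1 h with rfl | ⟨t, rfl, ht⟩
      · simp
      · simpa [ycost] using hq t ht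

lemma IsSchroder.u_append_d {i m : ℕ} {a b : List Step} (ha : IsSchroder i a)
    (hb : IsSchroder m b) : IsSchroder (i + m + 1) (Step.u :: a ++ Step.d :: b) := by
  obtain ⟨hax, hay, haq⟩ := ha
  obtain ⟨hbx, hby, hbq⟩ := hb
  refine ⟨?_, ?_, fun q h => ?_⟩
  · simp [xcost]
    omega
  · simp [ycost]
    omega
  · rw [List.cons_append] at h
    rcases List.prefix_cons_iff.1 h with rfl | ⟨t, rfl, ht⟩
    · simp
    · rcases ht.of_append with h1 | ⟨s, hs, rfl⟩
      · have := haq t h1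
        simp [ycost]
        omega
      · rcases List.prefix_cons_iff.1 hs with rfl | ⟨s', rfl, hs'⟩
        · simp [ycost]
          omega
        · have := hbq s' hs'
          simp [ycost]
          omega

/-- A path from height `h` that ends below the axis splits at its first step below the axis. -/
lemma exists_first_descent (p : List Step) (h : ℤ) (hh : 0 ≤ h)
    (hp : h + (p.map ycost).sum < 0) :
    ∃ a b, p = a ++ Step.d :: b ∧ h + (a.map ycost).sum = 0 ∧
      ∀ q, q <+: a → 0 ≤ h + (q.map ycost).sum := by
  induction p generalizing h with
  | nil => simp at hp; omega
  | cons s p ih =>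
    rw [List.map_cons, List.sum_cons, ← add_assoc] at hp
    by_cases hs : 0 ≤ h + ycost s
    · obtain ⟨a, b, rfl, ha, haq⟩ := ih _ hs hp
      refine ⟨s :: a, b, rfl, by simpa [add_assoc] using ha, fun q hq => ?_⟩
      rcases List.prefix_cons_iff.1 hq with rfl | ⟨t, rfl, ht⟩
      · simpa using hh
      · simpa [add_assoc] using haq t ht
    · cases s with
      | d =>
        have h0 : h = 0 := by
          simp only [ycost] at hs
          omega
        exact ⟨[], p, rfl, by simpa using h0, fun q hq => by simpa [List.prefix_nil.1 hq] using hh⟩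
      | u =>
        simp only [ycost] at hs
        omega
      | e =>
        simp only [ycost] at hs
        omega

lemma xcost_sum_emod_two (p : List Step) :
    ((p.map xcost).sum : ℤ) % 2 = (p.map ycost).sum % 2 := by
  induction p with
  | nil => simp
  | cons s p ih =>
    cases s <;> simp only [List.map_cons, List.sum_cons, xcost, ycost] <;> push_cast at * <;> omega

lemma IsSchroder.exists_decomposition {n : ℕ} {p : List Step}
    (hp : IsSchroder (n + 1) (Step.u :: p)) :
    ∃ i ≤ n, ∃ a b, IsSchroder i a ∧ IsSchroder (n - i) b ∧ p = a ++ Step.d :: b := by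
  obtain ⟨hx, hy, hq⟩ := hp
  obtain ⟨a, b, rfl, hay, haq⟩ := exists_first_descent p 0 le_rfl (by
    simp [ycost] at hy
    omega)
  simp only [zero_add] at hay haq
  have hpar := xcost_sum_emod_two a
  simp [xcost] at hx
  simp [ycost] at hy
  refine ⟨(a.map xcost).sum / 2, by omega, a, b, ⟨by omega, hay, haq⟩,
    ⟨by omega, by omega, fun q h => ?_⟩, rfl⟩
  have := hq (Step.u :: (a ++ Step.d :: q)) (by
    simpa [List.cons_prefix_cons, List.prefix_append_right_inj] using h)
  simp [ycost] at this
  omega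

lemma mem_Slist_iff (n : ℕ) (p : List Step) : p ∈ Slist n ↔ IsSchroder n p := by
  induction n using Nat.strong_induction_on generalizing p with
  | _ n ih =>
    cases n with
    | zero =>
      rw [Slist, List.mem_singleton]
      refine ⟨fun h => h ▸ IsSchroder.nil, fun ⟨hx, _⟩ => ?_⟩
      cases p with
      | nil => rfl
      | cons s p => cases s <;> simp [xcost] at hx
    | succ n =>
      rw [mem_Slist_succ]
      constructor
      · rintro (⟨q, hq, rfl⟩ | ⟨i, hi, a, ha, b, hb, rfl⟩)
        · exact (isSchroder_e_cons n q).2 ((ih n (by omega) q).1 hq)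
        · have := ((ih i (by omega) a).1 ha).u_append_d ((ih (n - i) (by omega) b).1 hb)
          rwa [Nat.add_sub_cancel' hi] at this
      · intro hp
        cases p with
        | nil => simp [IsSchroder] at hp
        | cons s p =>
          cases s with
          | e => exact Or.inl ⟨p, (ih n (by omega) p).2 ((isSchroder_e_cons n p).1 hp), rfl⟩
          | d =>
            have := hp.2.2 [Step.d] (by simp)
            simp [ycost] at this
          | u =>
            obtain ⟨i, hi, a, b, ha, hb, rfl⟩ := hp.exists_decomposition
            exact Or.inr ⟨i, hi, a, (ih i (by omega) a).2 ha, b,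
              (ih (n - i) (by omega) b).2 hb, rfl⟩

lemma IsSchroder.eq_of_append_d {i i' : ℕ} {a a' b b' : List Step} (ha : IsSchroder i a)
    (ha' : IsSchroder i' a') (h : a ++ Step.d :: b = a' ++ Step.d :: b') : a = a' ∧ b = b' := by
  have aux : ∀ {x y c z : List Step} {j k : ℕ}, IsSchroder j x → IsSchroder k y →
      y = x ++ c → Step.d :: z = c ++ Step.d :: b' ∨ Step.d :: z = c ++ Step.d :: b → c = [] := by
    intro x y c z j k hx hy hc hz
    cases c with
    | nil => rfl
    | cons s c =>
      have hs : s = Step.d := by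
        rcases hz with hz | hz <;> simp at hz <;> exact hz.1.symm
      subst hs hc
      have := hy.2.2 (x ++ [Step.d]) ⟨c, by simp⟩
      simp [ycost, hx.2.1] at this
  rcases List.append_eq_append_iff.1 h with ⟨c, hc, hz⟩ | ⟨c, hc, hz⟩
  · obtain rfl := aux ha ha' hc (Or.inl hz)
    simp_all
  · obtain rfl := aux ha' ha hc (Or.inr hz)
    simp_all

lemma IsSchroder.length_unique {i j : ℕ} {a : List Step} (hi : IsSchroder i a)
    (hj : IsSchroder j a) : i = j := by
  have := hi.1.symm.trans hj.1
  omega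

lemma nodup_returnPaths (n i : ℕ) (hi : (Slist i).Nodup) (hn : (Slist (n - i)).Nodup) :
    (returnPaths n i).Nodup := by
  refine List.nodup_flatMap.2 ⟨fun a _ => hn.map fun b b' h => by simpa using h, ?_⟩
  refine hi.imp_of_mem fun {a a'} ha ha' hne => ?_
  simp only [Function.onFun, List.disjoint_left, List.mem_map, not_exists, not_and]
  rintro _ ⟨b, _, rfl⟩ b' _ h
  exact hne (((mem_Slist_iff i a).1 ha).eq_of_append_d ((mem_Slist_iff i a').1 ha')
    (List.cons.inj h.symm).2).1

lemma nodup_Slist (n : ℕ) : (Slist n).Nodup := by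
  induction n using Nat.strong_induction_on with
  | _ n ih =>
    cases n with
    | zero => simp [Slist]
    | succ n =>
      rw [(Slist_succ_perm_returnPaths n).nodup_iff]
      refine List.Nodup.append ((ih n (by omega)).map fun _ _ h => (List.cons.inj h).2) ?_ ?_
      · refine List.nodup_flatMap.2 ⟨fun i hi => ?_, ?_⟩
        · rw [List.mem_range] at hi
          exact nodup_returnPaths n i (ih i hi) (ih (n - i) (by omega))
        · refine List.nodup_range.imp fun {i j} hij => ?_
          simp only [Function.onFun, List.disjoint_left, returnPaths, List.mem_flatMap,
            List.mem_map, not_exists, not_and]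
          rintro _ ⟨a, ha, b, _, rfl⟩ a' ha' b' _ h
          rw [mem_Slist_iff] at ha ha'
          obtain ⟨rfl, -⟩ := ha.eq_of_append_d ha' (List.cons.inj h.symm).2
          exact hij (ha.length_unique ha')
      · simp [List.disjoint_left, returnPaths]

/-- The list `𝒮_n` has exactly `r_n` entries and contains every Schröder path of
length `n` exactly once. -/
theorem Slist_length_and_contains_each_path_once :
    ∀ n : ℕ, (Slist n).length = schroder n ∧
      ∀ p : List Step, IsSchroder n p → (Slist n).count p = 1 :=
  fun n => ⟨length_Slist n, fun p hp =>
    List.count_eq_one_of_mem (nodup_Slist n) ((mem_Slist_iff n p).2 hp)⟩
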